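/- For every integer i ≥ 0 and every real number t ≠ 0, the i-th derivative at t of the function g(t) = 1/(1 - e^{-t}) equals ∑_{m=1}^{i+1} μ_{i,m}/(1 - e^{-t})^m, where μ_{i,m} = (-1)^{m+1} · (m-1)! · S(i+1, m). -/

import Mathlib

/-- The Stirling numbers of the second kind, via the explicit formula. -/
def S (n m : ℕ) : ℚ :=
  (1 / (m.factorial : ℚ)) *
    ∑ ℓ ∈ Finset.range (m + 1), (-1 : ℚ) ^ (m - ℓ) * (m.choose ℓ : ℚ) * (ℓ : ℚ) ^ n

/-- The coefficients `μ_{i,m} = (-1)^{m+1} (m-1)! S(i+1, m)`. -/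
def mu (i m : ℕ) : ℚ := (-1 : ℚ) ^ (m + 1) * ((m - 1).factorial : ℚ) * S (i + 1) m

lemma S_succ_succ (n m : ℕ) : S (n + 1) (m + 1) = (m + 1) * S n (m + 1) + S n m := by
  have key : (∑ l ∈ Finset.range (m + 1 + 1),
        (-1 : ℚ) ^ (m + 1 - l) * ((m + 1).choose l : ℚ) * (l : ℚ) ^ (n + 1))
      = (m + 1) * ((∑ l ∈ Finset.range (m + 1 + 1),
        (-1 : ℚ) ^ (m + 1 - l) * ((m + 1).choose l : ℚ) * (l : ℚ) ^ n)
      + ∑ l ∈ Finset.range (m + 1), (-1 : ℚ) ^ (m - l) * (m.choose l : ℚ) * (l : ℚ) ^ n) := by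
    rw [Finset.sum_range_succ _ (m + 1), Finset.sum_range_succ _ (m + 1), add_right_comm,
      ← Finset.sum_add_distrib, mul_add, Finset.mul_sum]
    congr 1
    · apply Finset.sum_congr rfl
      intro l hl
      have hl' : l ≤ m := by
        have := Finset.mem_range.mp hl
        omega
      have h1 : m + 1 - l = (m - l) + 1 := by omega
      have h2 := Nat.choose_mul_succ_eq m l
      have h3 : (m.choose l : ℚ) * (m + 1) = ((m + 1).choose l : ℚ) * (m + 1 - l) := by
        have h4 : ((m + 1 - l : ℕ) : ℚ) = (m : ℚ) + 1 - l := by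
          rw [Nat.cast_sub (by omega)]
          push_cast
          ring
        rw [← h4]
        exact_mod_cast h2
      rw [h1, pow_succ, pow_succ]
      linear_combination (-(-1 : ℚ) ^ (m - l) * (l : ℚ) ^ n) * h3
    · push_cast
      simp
      ring
  unfold S
  rw [key, Nat.factorial_succ]
  have h5 : (m.factorial : ℚ) ≠ 0 := by exact_mod_cast m.factorial_ne_zero
  have h6 : (m : ℚ) + 1 ≠ 0 := by positivity
  push_cast
  field_simp

lemma S_zero_succ (m : ℕ) : S 0 (m + 1) = 0 := by
  have h := add_pow (1 : ℚ) (-1) (m + 1)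
  simp only [one_pow, one_mul, add_neg_cancel] at h
  unfold S
  simp only [pow_zero, mul_one]
  rw [← h]
  simp

lemma S_succ_zero (n : ℕ) : S (n + 1) 0 = 0 := by
  simp [S]

lemma S_eq_zero (n : ℕ) : ∀ m, n < m → S n m = 0 := by
  induction n with
  | zero =>
    intro m hm
    obtain ⟨k, rfl⟩ : ∃ k, m = k + 1 := ⟨m - 1, by omega⟩
    exact S_zero_succ k
  | succ n ih =>
    intro m hm
    obtain ⟨k, rfl⟩ : ∃ k, m = k + 1 := ⟨m - 1, by omega⟩
    rw [S_succ_succ, ih _ (by omega), ih _ (by omega)]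
    simp

lemma mu_rec (i k : ℕ) : mu (i + 1) (k + 1) = (k + 1) * mu i (k + 1) - k * mu i k := by
  unfold mu
  rw [S_succ_succ]
  cases k with
  | zero => simp [S_succ_zero]
  | succ k =>
    simp only [Nat.add_sub_cancel, Nat.factorial_succ]
    push_cast
    ring

lemma mu_top (i : ℕ) : mu i (i + 2) = 0 := by
  simp [mu, S_eq_zero (i + 1) (i + 2) (by omega)]

lemma one_sub_exp_ne {t : ℝ} (ht : t ≠ 0) : 1 - Real.exp (-t) ≠ 0 := by
  intro h
  have h1 : Real.exp (-t) = 1 := by linarith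
  rw [Real.exp_eq_one_iff] at h1
  exact ht (by linarith)

lemma hasDerivAt_g {t : ℝ} (ht : t ≠ 0) :
    HasDerivAt (fun s : ℝ => (1 - Real.exp (-s))⁻¹)
      ((1 - Real.exp (-t))⁻¹ - ((1 - Real.exp (-t))⁻¹) ^ 2) t := by
  have h0 := one_sub_exp_ne ht
  have h := (((hasDerivAt_neg t).exp).const_sub 1).inv h0
  refine HasDerivAt.congr_deriv h ?_
  symm
  clear h
  generalize Real.exp (-t) = x at h0
  rw [eq_div_iff (pow_ne_zero 2 h0), sub_mul, ← mul_pow, inv_mul_cancel₀ h0, pow_two (1 - x),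
    ← mul_assoc, inv_mul_cancel₀ h0]
  ring

lemma aux (i : ℕ) : ∀ t : ℝ, t ≠ 0 →
    iteratedDeriv i (fun s : ℝ => 1 / (1 - Real.exp (-s))) t =
      ∑ k ∈ Finset.range (i + 1), (mu i (k + 1) : ℝ) * ((1 - Real.exp (-t))⁻¹) ^ (k + 1) := by
  induction i with
  | zero =>
    intro t ht
    have : mu 0 1 = 1 := by simp [mu, S, Finset.sum_range_succ]
    simp [this]
  | succ i ih =>
    intro t ht
    rw [iteratedDeriv_succ]
    have hev : iteratedDeriv i (fun s : ℝ => 1 / (1 - Real.exp (-s))) =ᶠ[nhds t]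
        fun s => ∑ k ∈ Finset.range (i + 1),
          (mu i (k + 1) : ℝ) * ((1 - Real.exp (-s))⁻¹) ^ (k + 1) := by
      filter_upwards [isOpen_ne.mem_nhds ht] with s hs
      exact ih s hs
    rw [hev.deriv_eq]
    have hd := HasDerivAt.fun_sum (u := Finset.range (i + 1)) (fun k _ =>
      ((hasDerivAt_g ht).pow (k + 1)).const_mul (mu i (k + 1) : ℝ))
    refine hd.deriv.trans ?_
    generalize (1 - Real.exp (-t))⁻¹ = y
    have e : ∀ k ∈ Finset.range (i + 1 + 1), (mu (i + 1) (k + 1) : ℝ) * y ^ (k + 1) =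
        (k + 1) * (mu i (k + 1) : ℝ) * y ^ (k + 1) - k * (mu i k : ℝ) * y ^ (k + 1) := by
      intro k _
      rw [mu_rec]
      push_cast
      ring
    rw [Finset.sum_congr rfl e, Finset.sum_sub_distrib,
      Finset.sum_range_succ (fun k : ℕ => ((k : ℝ) + 1) * (mu i (k + 1) : ℝ) * y ^ (k + 1)),
      Finset.sum_range_succ' (fun k : ℕ => (k : ℝ) * (mu i k : ℝ) * y ^ (k + 1)),
      show mu i (i + 1 + 1) = 0 from mu_top i]
    simp only [Rat.cast_zero, mul_zero, zero_mul, add_zero, Nat.cast_zero]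
    rw [← Finset.sum_sub_distrib]
    apply Finset.sum_congr rfl
    intro k _
    simp only [Nat.add_sub_cancel]
    push_cast
    ring

theorem iteratedDeriv_one_div_one_sub_exp_neg_mu (i : ℕ) (t : ℝ) (ht : t ≠ 0) :
    iteratedDeriv i (fun s : ℝ => 1 / (1 - Real.exp (-s))) t =
      ∑ m ∈ Finset.Icc 1 (i + 1), (mu i m : ℝ) / (1 - Real.exp (-t)) ^ m := by
  rw [aux i t ht, Finset.range_eq_Ico,
    Finset.sum_Ico_add' (fun m => (mu i m : ℝ) * ((1 - Real.exp (-t))⁻¹) ^ m) 0 (i + 1) 1]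
  apply Finset.sum_congr
  · ext m
    simp only [Finset.mem_Ico, Finset.mem_Icc]
    omega
  · intro m _
    rw [inv_pow, div_eq_mul_inv]
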